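/- arXiv:2501.12841 — 3 statements merged into one kernel-verified Lean document; each statement's English description precedes it below -/
import Mathlib

section
/- Let w* be a minimizer over the budget hyperplane H of the MVC objective f_MVC(w) = (γ/2)wᵀΣw + β‖w − w0‖₁ − μᵀw. Then there exists a vector g* ∈ ℝⁿ which is a subgradient of x ↦ ‖x − w0‖₁ at w*, such that w* is the unique minimizer over H of the MV objective with shifted mean μ̃ = μ − βg*, i.e. of the function w ↦ (γ/2)wᵀΣw − (μ − βg*)ᵀw. (Proposition 1: the MVC problem is equivalent to a classical mean–variance problem with conditional mean shifted by βg*.) -/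
open Matrix

/-- Right derivative of the absolute value. -/
noncomputable def absRight (u : ℝ) : ℝ := if 0 ≤ u then 1 else -1

/-- Left derivative of the absolute value. -/
noncomputable def absLeft (u : ℝ) : ℝ := if 0 < u then 1 else -1

lemma absLeft_le_absRight (u : ℝ) : absLeft u ≤ absRight u := by
  unfold absLeft absRight
  split_ifs <;> linarith

lemma abs_subgradient {u g : ℝ} (h₁ : absLeft u ≤ g) (h₂ : g ≤ absRight u) (v : ℝ) :
    |u| + g * (v - u) ≤ |v| := by
  unfold absLeft at h₁
  unfold absRight at h₂
  rcases lt_trichotomy u 0 with h | rfl | h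
  · rw [if_neg (by linarith)] at h₁ h₂
    obtain rfl : g = -1 := le_antisymm h₂ h₁
    rw [abs_of_neg h]
    linarith [neg_abs_le v]
  · simp only [lt_irrefl, le_refl, if_true, if_false] at h₁ h₂
    have hg : |g| ≤ 1 := abs_le.2 ⟨h₁, h₂⟩
    have := mul_le_mul_of_nonneg_right hg (abs_nonneg v)
    rw [← abs_mul] at this
    simpa using (le_abs_self _).trans this
  · rw [if_pos h] at h₁
    rw [if_pos h.le] at h₂
    obtain rfl : g = 1 := le_antisymm h₂ h₁
    rw [abs_of_pos h]
    linarith [le_abs_self v]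

open Filter Topology in
lemma eventually_abs_add (u : ℝ) :
    ∀ᶠ t : ℝ in 𝓝[>] 0, |u + t| = |u| + t * absRight u := by
  unfold absRight
  split_ifs with h
  · filter_upwards [self_mem_nhdsWithin] with t (ht : 0 < t)
    rw [abs_of_nonneg h, abs_of_nonneg (by linarith), mul_one]
  · filter_upwards [Ioo_mem_nhdsGT (show (0 : ℝ) < -u by linarith)] with t ht
    rw [abs_of_neg (show u < 0 by linarith), abs_of_neg (by linarith [ht.2])]
    ring

open Filter Topology in
lemma eventually_abs_sub (u : ℝ) :
    ∀ᶠ t : ℝ in 𝓝[>] 0, |u - t| = |u| - t * absLeft u := by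
  unfold absLeft
  split_ifs with h
  · filter_upwards [Ioo_mem_nhdsGT h] with t ht
    rw [abs_of_pos h, abs_of_pos (by linarith [ht.2]), mul_one]
  · filter_upwards [self_mem_nhdsWithin] with t (ht : 0 < t)
    rw [abs_of_nonpos (show u ≤ 0 by linarith), abs_of_nonpos (by linarith)]
    ring

open Filter Topology in
lemma nonneg_of_eventually_quadratic {A K : ℝ}
    (h : ∀ᶠ t : ℝ in 𝓝[>] 0, 0 ≤ t * A + t ^ 2 * K) : 0 ≤ A := by
  have hlim : Tendsto (fun t : ℝ => A + t * K) (𝓝[>] 0) (𝓝 A) := by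
    have : Continuous fun t : ℝ => A + t * K := by fun_prop
    simpa using (this.tendsto 0).mono_left nhdsWithin_le_nhds
  refine ge_of_tendsto hlim ?_
  filter_upwards [h, self_mem_nhdsWithin] with t ht (h0 : 0 < t)
  refine nonneg_of_mul_nonneg_right (a := t) ?_ h0
  linarith

lemma Matrix.IsSymm.quadratic_add {ι : Type*} [Fintype ι] {S : Matrix ι ι ℝ}
    (hS : S.IsSymm) (a d : ι → ℝ) :
    (a + d) ⬝ᵥ (S *ᵥ (a + d)) =
      a ⬝ᵥ (S *ᵥ a) + 2 * ((S *ᵥ a) ⬝ᵥ d) + d ⬝ᵥ (S *ᵥ d) := by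
  have h : a ⬝ᵥ (S *ᵥ d) = (S *ᵥ a) ⬝ᵥ d := by
    rw [dotProduct_mulVec, ← mulVec_transpose, hS.eq]
  rw [mulVec_add, dotProduct_add, add_dotProduct, add_dotProduct, h,
    dotProduct_comm d (S *ᵥ a)]
  ring

open Filter Topology in
/-- First-order optimality for moving budget from coordinate `j` to coordinate `i`. -/
lemma marginal_le_of_minimizer {ι : Type*} [Fintype ι] [DecidableEq ι] {S : Matrix ι ι ℝ}
    (hsym : S.IsSymm) {γ β : ℝ} (hβ : 0 ≤ β) {μ w0 a : ι → ℝ}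
    (hmin : ∀ w : ι → ℝ, ∑ k, w k = ∑ k, a k →
      γ / 2 * (a ⬝ᵥ (S *ᵥ a)) + β * (∑ i, |a i - w0 i|) - μ ⬝ᵥ a ≤
      γ / 2 * (w ⬝ᵥ (S *ᵥ w)) + β * (∑ i, |w i - w0 i|) - μ ⬝ᵥ w) (i j : ι) :
    γ * (S *ᵥ a) j - μ j + β * absLeft (a j - w0 j) ≤
      γ * (S *ᵥ a) i - μ i + β * absRight (a i - w0 i) := by
  rcases eq_or_ne i j with rfl | hij
  · gcongr
    exact absLeft_le_absRight _
  set d : ι → ℝ := Pi.single i 1 - Pi.single j 1 with hd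
  rw [← sub_nonneg]
  refine nonneg_of_eventually_quadratic (K := γ / 2 * (d ⬝ᵥ (S *ᵥ d))) ?_
  filter_upwards [eventually_abs_add (a i - w0 i), eventually_abs_sub (a j - w0 j)]
    with t hi hj
  have habs : ∑ k, |(a + t • d) k - w0 k| = ∑ k, |a k - w0 k| +
      t * (absRight (a i - w0 i) - absLeft (a j - w0 j)) := by
    have hk : ∀ k, |(a + t • d) k - w0 k| = |a k - w0 k| +
        t * (Pi.single (M := fun _ => ℝ) i (absRight (a i - w0 i)) k -
          Pi.single (M := fun _ => ℝ) j (absLeft (a j - w0 j)) k) := by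
      intro k
      rcases eq_or_ne k i with rfl | hki
      · simp [hd, hij, ← hi, add_sub_right_comm]
      rcases eq_or_ne k j with rfl | hkj
      · simp only [hd, Pi.add_apply, Pi.smul_apply, Pi.sub_apply, Pi.single_eq_same,
          Pi.single_eq_of_ne hki, smul_eq_mul]
        rw [show a k + t * (0 - 1) - w0 k = a k - w0 k - t by ring, hj]
        ring
      · simp [hd, hki, hkj]
    rw [Finset.sum_congr rfl fun k _ => hk k, Finset.sum_add_distrib, ← Finset.mul_sum,
      Finset.sum_sub_distrib]
    simp
  have h := hmin (a + t • d) (by simp [hd, Finset.sum_add_distrib, ← Finset.mul_sum])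
  have hdot : ∀ v : ι → ℝ, v ⬝ᵥ d = v i - v j := fun v => by simp [hd, dotProduct_sub]
  rw [hsym.quadratic_add, habs, mulVec_smul, dotProduct_add, dotProduct_smul, smul_dotProduct,
    dotProduct_smul, dotProduct_smul, hdot, hdot] at h
  simp only [smul_eq_mul] at h
  linarith

/-- Proposition 1: a minimizer of the MVC objective over the budget hyperplane is the
unique minimizer of the MV objective with mean shifted by `β • g*` for some subgradient
`g*` of the L1 turnover penalty at the optimum. -/
theorem stmt_0 {n : ℕ} (hn : 1 ≤ n) (S : Matrix (Fin n) (Fin n) ℝ)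
    (hS : S.PosDef) (hsym : S.IsSymm)
    (γ β : ℝ) (hγ : 0 < γ) (hβ : 0 ≤ β)
    (μ w0 : Fin n → ℝ) (l : Fin n → ℝ) (hl : l = fun _ => (1 : ℝ))
    (wstar : Fin n → ℝ) (hws : l ⬝ᵥ wstar = 1)
    (hmin : ∀ w : Fin n → ℝ, l ⬝ᵥ w = 1 →
      γ / 2 * (wstar ⬝ᵥ (S *ᵥ wstar)) + β * (∑ i, |wstar i - w0 i|) - μ ⬝ᵥ wstar ≤
      γ / 2 * (w ⬝ᵥ (S *ᵥ w)) + β * (∑ i, |w i - w0 i|) - μ ⬝ᵥ w) :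
    ∃ g : Fin n → ℝ,
      (∀ x : Fin n → ℝ,
        (∑ i, |wstar i - w0 i|) + g ⬝ᵥ (x - wstar) ≤ ∑ i, |x i - w0 i|) ∧
      (∀ w : Fin n → ℝ, l ⬝ᵥ w = 1 →
        γ / 2 * (wstar ⬝ᵥ (S *ᵥ wstar)) - (μ - β • g) ⬝ᵥ wstar ≤
        γ / 2 * (w ⬝ᵥ (S *ᵥ w)) - (μ - β • g) ⬝ᵥ w) ∧
      (∀ w : Fin n → ℝ, l ⬝ᵥ w = 1 →
        γ / 2 * (w ⬝ᵥ (S *ᵥ w)) - (μ - β • g) ⬝ᵥ w =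
        γ / 2 * (wstar ⬝ᵥ (S *ᵥ wstar)) - (μ - β • g) ⬝ᵥ wstar → w = wstar) := by
  subst hl
  have hsum : ∀ w : Fin n → ℝ, (fun _ => (1 : ℝ)) ⬝ᵥ w = ∑ k, w k := fun w => by
    simp [dotProduct]
  simp only [hsum] at *
  have hpair := marginal_le_of_minimizer hsym hβ (fun w hw => hmin w (hw.trans hws))
  have : Nonempty (Fin n) := ⟨⟨0, hn⟩⟩
  obtain ⟨j₀, hj₀⟩ := Finite.exists_max
    fun j => γ * (S *ᵥ wstar) j - μ j + β * absLeft (wstar j - w0 j)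
  set ν := γ * (S *ᵥ wstar) j₀ - μ j₀ + β * absLeft (wstar j₀ - w0 j₀)
  have hg : ∀ i, ∃ g, absLeft (wstar i - w0 i) ≤ g ∧ g ≤ absRight (wstar i - w0 i) ∧
      γ * (S *ᵥ wstar) i - μ i + β * g = ν := by
    intro i
    have hlow := hj₀ i
    have hupp := hpair i j₀
    rcases hβ.eq_or_lt with rfl | hpos
    · exact ⟨_, le_rfl, absLeft_le_absRight _, by linarith⟩
    · refine ⟨(ν - (γ * (S *ᵥ wstar) i - μ i)) / β, ?_, ?_, ?_⟩
      · rw [le_div_iff₀ hpos]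
        linarith
      · rw [div_le_iff₀ hpos]
        linarith
      · field_simp
        ring
  choose g hgl hgr hgν using hg
  have hexp : ∀ w : Fin n → ℝ, ∑ k, w k = 1 →
      γ / 2 * (w ⬝ᵥ (S *ᵥ w)) - (μ - β • g) ⬝ᵥ w =
        γ / 2 * (wstar ⬝ᵥ (S *ᵥ wstar)) - (μ - β • g) ⬝ᵥ wstar +
          γ / 2 * ((w - wstar) ⬝ᵥ (S *ᵥ (w - wstar))) := by
    intro w hw
    have hq := hsym.quadratic_add wstar (w - wstar)
    rw [add_sub_cancel] at hq
    have hgrad : γ * ((S *ᵥ wstar) ⬝ᵥ (w - wstar)) - (μ - β • g) ⬝ᵥ (w - wstar) = 0 := by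
      have hν : γ • (S *ᵥ wstar) - (μ - β • g) = fun _ => ν := by
        ext i
        simp only [Pi.sub_apply, Pi.smul_apply, smul_eq_mul]
        linarith [hgν i]
      rw [← smul_eq_mul, ← smul_dotProduct, ← sub_dotProduct, hν]
      simp [dotProduct, ← Finset.mul_sum, hw, hws]
    rw [dotProduct_sub (μ - β • g)] at hgrad
    rw [hq]
    linarith
  refine ⟨g, fun x => ?_, fun w hw => ?_, fun w hw heq => ?_⟩
  · rw [dotProduct, ← Finset.sum_add_distrib]
    refine Finset.sum_le_sum fun i _ => ?_
    simpa using abs_subgradient (hgl i) (hgr i) (x i - w0 i)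
  · have := hS.posSemidef.dotProduct_mulVec_nonneg (w - wstar)
    rw [star_trivial] at this
    rw [hexp w hw]
    linarith [mul_nonneg (half_pos hγ).le this]
  · by_contra hne
    have := hS.dotProduct_mulVec_pos (sub_ne_zero.2 hne)
    rw [star_trivial] at this
    rw [hexp w hw] at heq
    linarith [mul_pos (half_pos hγ) this]
end

section
/- Let w* be a minimizer over the budget hyperplane H of the GMVC objective w ↦ (γ/2)wᵀΣw + β‖w − w0‖₁. Then there exists a vector g* ∈ ℝⁿ which is a subgradient of x ↦ ‖x − w0‖₁ at w*, such that, setting Σ_{β/γ} = Σ + (β/γ)(g* lᵀ + l (g*)ᵀ), the point w* minimizes the quadratic form w ↦ wᵀ Σ_{β/γ} w over H. (The GMVC problem is equivalent to a traditional global minimum-variance problem with the regularized covariance matrix Σ_{β/γ}.) -/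
open Matrix

/-- The left derivative of the absolute value at `u`. -/
noncomputable def absLeftDeriv (u : ℝ) : ℝ := if 0 < u then 1 else -1

/-- The right derivative of the absolute value at `u`. -/
noncomputable def absRightDeriv (u : ℝ) : ℝ := if u < 0 then -1 else 1

theorem absLeftDeriv_le_absRightDeriv (u : ℝ) : absLeftDeriv u ≤ absRightDeriv u := by
  unfold absLeftDeriv absRightDeriv
  split_ifs <;> linarith

theorem exists_abs_add_eq (u : ℝ) :
    ∃ ε > 0, ∀ t, 0 < t → t ≤ ε → |u + t| = |u| + t * absRightDeriv u := by
  unfold absRightDeriv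
  rcases lt_or_ge u 0 with hu | hu
  · refine ⟨-u, by linarith, fun t _ hte => ?_⟩
    rw [if_pos hu, abs_of_neg hu, abs_of_nonpos (by linarith)]
    ring
  · refine ⟨1, one_pos, fun t ht _ => ?_⟩
    rw [if_neg hu.not_gt, abs_of_nonneg hu, abs_of_nonneg (by linarith)]
    ring

theorem exists_abs_sub_eq (u : ℝ) :
    ∃ ε > 0, ∀ t, 0 < t → t ≤ ε → |u - t| = |u| - t * absLeftDeriv u := by
  unfold absLeftDeriv
  rcases lt_or_ge 0 u with hu | hu
  · refine ⟨u, hu, fun t _ hte => ?_⟩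
    rw [if_pos hu, abs_of_pos hu, abs_of_nonneg (by linarith)]
    ring
  · refine ⟨1, one_pos, fun t ht _ => ?_⟩
    rw [if_neg hu.not_gt, abs_of_nonpos hu, abs_of_nonpos (by linarith)]
    ring

/-- Every number between the one-sided derivatives is a subgradient of the absolute value. -/
theorem abs_add_mul_sub_le {u g : ℝ} (hleft : absLeftDeriv u ≤ g) (hright : g ≤ absRightDeriv u)
    (v : ℝ) : |u| + g * (v - u) ≤ |v| := by
  unfold absLeftDeriv at hleft
  unfold absRightDeriv at hright
  rcases lt_trichotomy u 0 with hu | hu | hu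
  · rw [if_neg hu.not_gt] at hleft
    rw [if_pos hu] at hright
    obtain rfl : g = -1 := le_antisymm hright hleft
    rw [abs_of_neg hu]
    linarith [neg_le_abs v]
  · subst hu
    simp only [lt_irrefl, if_false] at hleft hright
    rw [abs_zero, sub_zero, zero_add]
    calc g * v ≤ |g * v| := le_abs_self _
      _ = |g| * |v| := abs_mul g v
      _ ≤ 1 * |v| := by gcongr; exact abs_le.2 ⟨hleft, hright⟩
      _ = |v| := one_mul _
  · rw [if_pos hu] at hleft
    rw [if_neg hu.not_gt] at hright
    obtain rfl : g = 1 := le_antisymm hright hleft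
    rw [abs_of_pos hu]
    linarith [le_abs_self v]

theorem nonneg_of_forall_small_nonneg {A B ε : ℝ} (hε : 0 < ε)
    (h : ∀ t, 0 < t → t ≤ ε → 0 ≤ t * (A + t * B)) : 0 ≤ A := by
  by_contra! hA
  have hB : 0 < |B| + 1 := by positivity
  set t := min ε (-A / (2 * (|B| + 1)))
  have htpos : 0 < t := lt_min hε (div_pos (by linarith) (by positivity))
  have htA : t * (2 * (|B| + 1)) ≤ -A := (le_div_iff₀ (by positivity)).1 (min_le_right _ _)
  have hnn := nonneg_of_mul_nonneg_right (h t htpos (min_le_left _ _)) htpos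
  have htB : t * B ≤ t * |B| := by gcongr; exact le_abs_self B
  nlinarith

theorem quadraticForm_add {n : ℕ} {S : Matrix (Fin n) (Fin n) ℝ} (hsym : S.IsSymm)
    (w d : Fin n → ℝ) :
    (w + d) ⬝ᵥ (S *ᵥ (w + d)) = w ⬝ᵥ (S *ᵥ w) + 2 * (d ⬝ᵥ (S *ᵥ w)) + d ⬝ᵥ (S *ᵥ d) := by
  have hcomm : w ⬝ᵥ (S *ᵥ d) = d ⬝ᵥ (S *ᵥ w) := by
    rw [dotProduct_mulVec, ← mulVec_transpose, hsym.eq, dotProduct_comm]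
  rw [mulVec_add, add_dotProduct, dotProduct_add, dotProduct_add, hcomm]
  ring

/-- A rank-two perturbation by `g lᵀ + l gᵀ` acts linearly on the hyperplane `lᵀ w = 1`. -/
theorem quadraticForm_regularized {n : ℕ} (S : Matrix (Fin n) (Fin n) ℝ) (c : ℝ)
    (g : Fin n → ℝ) {l w : Fin n → ℝ} (hw : l ⬝ᵥ w = 1) :
    w ⬝ᵥ ((S + c • (vecMulVec g l + vecMulVec l g)) *ᵥ w) =
      w ⬝ᵥ (S *ᵥ w) + 2 * c * (g ⬝ᵥ w) := by
  have hw' : w ⬝ᵥ l = 1 := by rw [dotProduct_comm, hw]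
  simp only [add_mulVec, smul_mulVec, vecMulVec_mulVec, dotProduct_add, dotProduct_smul,
    op_smul_eq_smul, hw, hw', smul_eq_mul, dotProduct_comm w g]
  ring

/-- First-order optimality along the exchange direction `eⱼ - eᵢ`. -/
theorem leftDeriv_le_rightDeriv_of_isMin {n : ℕ} {S : Matrix (Fin n) (Fin n) ℝ}
    (hsym : S.IsSymm) {γ β : ℝ} (hβ : 0 ≤ β) {w0 w : Fin n → ℝ}
    (hw : (fun _ => (1 : ℝ)) ⬝ᵥ w = 1)
    (hmin : ∀ x : Fin n → ℝ, (fun _ => (1 : ℝ)) ⬝ᵥ x = 1 →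
      γ / 2 * (w ⬝ᵥ (S *ᵥ w)) + β * (∑ i, |w i - w0 i|) ≤
      γ / 2 * (x ⬝ᵥ (S *ᵥ x)) + β * (∑ i, |x i - w0 i|)) (i j : Fin n) :
    γ * (S *ᵥ w) i + β * absLeftDeriv (w i - w0 i) ≤
      γ * (S *ᵥ w) j + β * absRightDeriv (w j - w0 j) := by
  rcases eq_or_ne i j with rfl | hij
  · gcongr
    exact absLeftDeriv_le_absRightDeriv _
  obtain ⟨ε₁, hε₁, h₁⟩ := exists_abs_sub_eq (w i - w0 i)
  obtain ⟨ε₂, hε₂, h₂⟩ := exists_abs_add_eq (w j - w0 j)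
  set d : Fin n → ℝ := Pi.single j 1 - Pi.single i 1 with hd
  have hone : (fun _ => (1 : ℝ)) ⬝ᵥ d = 0 := by simp [hd, dotProduct_sub]
  have hgrad : d ⬝ᵥ (S *ᵥ w) = (S *ᵥ w) j - (S *ᵥ w) i := by
    simp [hd, sub_dotProduct]
  have key := nonneg_of_forall_small_nonneg
    (A := γ * ((S *ᵥ w) j - (S *ᵥ w) i) +
      β * (absRightDeriv (w j - w0 j) - absLeftDeriv (w i - w0 i)))
    (B := γ / 2 * (d ⬝ᵥ (S *ᵥ d))) (lt_min hε₁ hε₂) fun t ht hte => by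
      have habs : ∑ k, |(w + t • d) k - w0 k| = ∑ k, |w k - w0 k| +
          t * (absRightDeriv (w j - w0 j) - absLeftDeriv (w i - w0 i)) := by
        have hk : ∀ k, |(w + t • d) k - w0 k| = |w k - w0 k| +
            ((Pi.single j (t * absRightDeriv (w j - w0 j)) : Fin n → ℝ) k -
              (Pi.single i (t * absLeftDeriv (w i - w0 i)) : Fin n → ℝ) k) := by
          intro k
          rcases eq_or_ne k i with rfl | hki
          · have := h₁ t ht (hte.trans (min_le_left _ _))
            simp only [hd, Pi.add_apply, Pi.smul_apply, Pi.sub_apply, Pi.single_eq_same,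
              Pi.single_eq_of_ne hij, smul_eq_mul]
            rw [show w k + t * (0 - 1) - w0 k = w k - w0 k - t by ring, this]
            ring
          · rcases eq_or_ne k j with rfl | hkj
            · have := h₂ t ht (hte.trans (min_le_right _ _))
              simp only [hd, Pi.add_apply, Pi.smul_apply, Pi.sub_apply, Pi.single_eq_same,
                Pi.single_eq_of_ne hki, smul_eq_mul]
              rw [show w k + t * (1 - 0) - w0 k = w k - w0 k + t by ring, this]
              ring
            · simp [hd, Pi.single_eq_of_ne hki, Pi.single_eq_of_ne hkj]
        simp only [hk, Finset.sum_add_distrib, Finset.sum_sub_distrib,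
          Finset.sum_pi_single', Finset.mem_univ, if_true]
        ring
      have := hmin (w + t • d) (by rw [dotProduct_add, dotProduct_smul, hone, hw]; simp)
      rw [habs, quadraticForm_add hsym, mulVec_smul, smul_dotProduct, smul_dotProduct,
        dotProduct_smul, hgrad] at this
      simp only [smul_eq_mul] at this
      linarith
  linarith

/-- The GMVC problem is equivalent to a traditional global minimum-variance problem with
the regularized covariance `Σ + (β/γ)(g* lᵀ + l g*ᵀ)` for some subgradient `g*` of the
L1 turnover penalty at the optimum. -/
theorem stmt_4 {n : ℕ} (hn : 1 ≤ n) (S : Matrix (Fin n) (Fin n) ℝ)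
    (hS : S.PosDef) (hsym : S.IsSymm)
    (γ β : ℝ) (hγ : 0 < γ) (hβ : 0 ≤ β)
    (w0 : Fin n → ℝ) (l : Fin n → ℝ) (hl : l = fun _ => (1 : ℝ))
    (wstar : Fin n → ℝ) (hws : l ⬝ᵥ wstar = 1)
    (hmin : ∀ w : Fin n → ℝ, l ⬝ᵥ w = 1 →
      γ / 2 * (wstar ⬝ᵥ (S *ᵥ wstar)) + β * (∑ i, |wstar i - w0 i|) ≤
      γ / 2 * (w ⬝ᵥ (S *ᵥ w)) + β * (∑ i, |w i - w0 i|)) :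
    ∃ g : Fin n → ℝ,
      (∀ x : Fin n → ℝ,
        (∑ i, |wstar i - w0 i|) + g ⬝ᵥ (x - wstar) ≤ ∑ i, |x i - w0 i|) ∧
      (∀ w : Fin n → ℝ, l ⬝ᵥ w = 1 →
        wstar ⬝ᵥ ((S + (β / γ) • (vecMulVec g l + vecMulVec l g)) *ᵥ wstar) ≤
        w ⬝ᵥ ((S + (β / γ) • (vecMulVec g l + vecMulVec l g)) *ᵥ w)) := by
  subst hl
  have hpair := leftDeriv_le_rightDeriv_of_isMin hsym hβ hws hmin
  have : Nonempty (Fin n) := ⟨⟨0, hn⟩⟩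
  obtain ⟨m, hm⟩ := Finite.exists_max
    fun i => γ * (S *ᵥ wstar) i + β * absLeftDeriv (wstar i - w0 i)
  set μ := γ * (S *ᵥ wstar) m + β * absLeftDeriv (wstar m - w0 m)
  have hcoord : ∀ i, ∃ y, absLeftDeriv (wstar i - w0 i) ≤ y ∧
      y ≤ absRightDeriv (wstar i - w0 i) ∧ β * y = μ - γ * (S *ᵥ wstar) i := by
    intro i
    have hlo := hm i
    have hup := hpair m i
    rcases hβ.eq_or_lt with rfl | hpos
    · exact ⟨_, le_rfl, absLeftDeriv_le_absRightDeriv _, by linarith⟩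
    · refine ⟨(μ - γ * (S *ᵥ wstar) i) / β, ?_, ?_, by field_simp⟩
      · rw [le_div_iff₀ hpos]; linarith
      · rw [div_le_iff₀ hpos]; linarith
  choose g hleft hright hg using hcoord
  refine ⟨g, fun x => ?_, fun w hw => ?_⟩
  · rw [dotProduct, ← Finset.sum_add_distrib]
    refine Finset.sum_le_sum fun i _ => ?_
    have := abs_add_mul_sub_le (hleft i) (hright i) (x i - w0 i)
    rwa [sub_sub_sub_cancel_right] at this
  · rw [quadraticForm_regularized S _ g hws, quadraticForm_regularized S _ g hw]
    obtain ⟨d, rfl⟩ : ∃ d, w = wstar + d := ⟨w - wstar, by abel⟩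
    have hd : (fun _ => (1 : ℝ)) ⬝ᵥ d = 0 := by
      rw [dotProduct_add, hws] at hw
      linarith
    have hgd : β * (g ⬝ᵥ d) = -(γ * (d ⬝ᵥ (S *ᵥ wstar))) := by
      have hvec : β • g = μ • (fun _ => (1 : ℝ)) - γ • (S *ᵥ wstar) := by
        ext i
        simpa using hg i
      rw [← smul_eq_mul, ← smul_dotProduct, hvec, sub_dotProduct, smul_dotProduct, hd,
        smul_dotProduct, dotProduct_comm d]
      simp
    have hcancel : β / γ * (g ⬝ᵥ d) = -(d ⬝ᵥ (S *ᵥ wstar)) := by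
      rw [div_mul_eq_mul_div, hgd]
      field_simp
    have hpsd : 0 ≤ d ⬝ᵥ (S *ᵥ d) := by
      simpa using hS.posSemidef.dotProduct_mulVec_nonneg d
    rw [quadraticForm_add hsym, dotProduct_add]
    linarith
end

section
/- Let w* be the minimizer over the budget hyperplane H of the MVC objective f_MVC(w) = (γ/2)wᵀΣw + β‖w − w0‖₁ − μᵀw, and let g* be a subgradient of x ↦ ‖x − w0‖₁ at w* satisfying the first-order condition γΣw* + βg* − μ = λl for some λ ∈ ℝ. Then w* admits the explicit representation w* = (1/γ)(Σ⁻¹ − (Σ⁻¹ l lᵀ Σ⁻¹)/(lᵀΣ⁻¹l))(μ − βg*) + (Σ⁻¹ l)/(lᵀΣ⁻¹l). (The closed-form solution of the MVC problem derived in the proof of Proposition 1.) -/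
open Matrix

theorem Matrix.mul_vecMulVec_mul_mulVec {m n R : Type*} [Fintype m] [Fintype n] [CommSemiring R]
    (A : Matrix m n R) (B : Matrix n m R) (x y : n → R) (v : m → R) :
    (A * vecMulVec x y * B) *ᵥ v = (y ⬝ᵥ (B *ᵥ v)) • (A *ᵥ x) := by
  rw [← mulVec_mulVec, ← mulVec_mulVec, vecMulVec_mulVec, op_smul_eq_smul, mulVec_smul]

/-- Closed-form solution of the MVC problem: if `w*` minimizes the MVC objective over the
budget hyperplane and `g*` is a subgradient of the L1 turnover penalty at `w*` satisfying
the first-order condition `γ Σ w* + β g* − μ = λ l`, then `w*` is given by the classical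
efficient-portfolio formula with shifted mean `μ − β g*`. -/
theorem stmt_15 {n : ℕ} (hn : 1 ≤ n) (S : Matrix (Fin n) (Fin n) ℝ)
    (hS : S.PosDef) (hsym : S.IsSymm)
    (γ β : ℝ) (hγ : 0 < γ) (hβ : 0 ≤ β)
    (μ w0 : Fin n → ℝ) (l : Fin n → ℝ) (hl : l = fun _ => (1 : ℝ))
    (wstar g : Fin n → ℝ) (lam : ℝ)
    (hws : l ⬝ᵥ wstar = 1)
    (hmin : ∀ w : Fin n → ℝ, l ⬝ᵥ w = 1 →
      γ / 2 * (wstar ⬝ᵥ (S *ᵥ wstar)) + β * (∑ i, |wstar i - w0 i|) - μ ⬝ᵥ wstar ≤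
      γ / 2 * (w ⬝ᵥ (S *ᵥ w)) + β * (∑ i, |w i - w0 i|) - μ ⬝ᵥ w)
    (hg : ∀ x : Fin n → ℝ,
      (∑ i, |wstar i - w0 i|) + g ⬝ᵥ (x - wstar) ≤ ∑ i, |x i - w0 i|)
    (hfoc : γ • (S *ᵥ wstar) + β • g - μ = lam • l) :
    wstar =
      (1 / γ) • ((S⁻¹ - (1 / (l ⬝ᵥ (S⁻¹ *ᵥ l))) • (S⁻¹ * vecMulVec l l * S⁻¹)) *ᵥ (μ - β • g))
        + (1 / (l ⬝ᵥ (S⁻¹ *ᵥ l))) • (S⁻¹ *ᵥ l) := by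
  have hl0 : l ≠ 0 := fun h => by simp [h] at hws
  have ha : l ⬝ᵥ (S⁻¹ *ᵥ l) ≠ 0 := by
    simpa using (hS.inv.dotProduct_mulVec_pos hl0).ne'
  have hv : μ - β • g = γ • (S *ᵥ wstar) - lam • l := by
    rw [← hfoc]
    abel
  have hinv : S⁻¹ *ᵥ (μ - β • g) = γ • wstar - lam • (S⁻¹ *ᵥ l) := by
    rw [hv, mulVec_sub, mulVec_smul, mulVec_smul, mulVec_mulVec,
      nonsing_inv_mul S (S.isUnit_iff_isUnit_det.mp hS.isUnit), one_mulVec]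
  rw [sub_mulVec, smul_mulVec, mul_vecMulVec_mul_mulVec, hinv, dotProduct_sub, dotProduct_smul,
    dotProduct_smul, hws]
  ext i
  simp only [Pi.add_apply, Pi.sub_apply, Pi.smul_apply, smul_eq_mul]
  field_simp
  ring
end
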